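/- Kalman prediction (marginalization) step of the forward filter: Let P, Q ∈ ℝ^{n×n} be symmetric positive definite, A ∈ ℝ^{n×n}, B ∈ ℝ^{n×q}, μ ∈ ℝ^n, u ∈ ℝ^q. Then for every x' ∈ ℝ^n, ∫_{ℝ^n} N(x' | Ax + Bu, Q) · N(x | μ, P) dx = N(x' | Aμ + Bu, APAᵀ + Q). -/

import Mathlib

open MeasureTheory Matrix Real

noncomputable def gaussPdf {n : ℕ} (x μ : Fin n → ℝ) (P : Matrix (Fin n) (Fin n) ℝ) : ℝ :=
  ((2 * Real.pi) • P).det ^ (-(1:ℝ)/2) *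
    Real.exp (-(1/2) * ((x - μ) ⬝ᵥ (P⁻¹ *ᵥ (x - μ))))

noncomputable def infoLik {n : ℕ} (x : Fin n → ℝ) (r : ℝ) (s : Fin n → ℝ)
    (L : Matrix (Fin n) (Fin n) ℝ) : ℝ :=
  Real.exp (-(1/2) * (r + 2 * (x ⬝ᵥ s) + x ⬝ᵥ (L *ᵥ x)))

theorem integral_exp_neg_half_dotProduct_self (n : ℕ) :
    ∫ x : Fin n → ℝ, Real.exp (-(1 / 2) * (x ⬝ᵥ x)) = √(2 * π) ^ n := by
  have h (x : Fin n → ℝ) :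
      Real.exp (-(1 / 2) * (x ⬝ᵥ x)) = ∏ i, Real.exp (-(1 / 2) * x i ^ 2) := by
    simp_rw [← Real.exp_sum, ← Finset.mul_sum, dotProduct, pow_two]
  simp_rw [h]
  rw [integral_fintype_prod_volume_eq_pow fun t : ℝ => Real.exp (-(1 / 2) * t ^ 2),
    integral_gaussian, Fintype.card_fin, div_div_eq_mul_div, div_one, mul_comm]

theorem integral_comp_mulVec {n : ℕ} (f : (Fin n → ℝ) → ℝ) {M : Matrix (Fin n) (Fin n) ℝ}
    (hM : M.det ≠ 0) : ∫ x, f (M *ᵥ x) = |M.det|⁻¹ * ∫ x, f x := by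
  let e : (Fin n → ℝ) ≃L[ℝ] (Fin n → ℝ) :=
    (LinearMap.equivOfDetNeZero (toLin' M)
      (by rwa [LinearMap.det_toLin'])).toContinuousLinearEquiv
  have h := e.toHomeomorph.measurableEmbedding.integral_map (μ := volume) f
  have hc : ⇑e.toHomeomorph = toLin' M := rfl
  rw [hc, Real.map_matrix_volume_pi_eq_smul_volume_pi hM, integral_smul_measure,
    ENNReal.toReal_ofReal (abs_nonneg _), abs_inv, smul_eq_mul] at h
  simpa using h.symm

theorem integral_exp_neg_half_quadratic {n : ℕ} {M : Matrix (Fin n) (Fin n) ℝ} (hM : M.PosDef) :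
    ∫ x : Fin n → ℝ, Real.exp (-(1 / 2) * (x ⬝ᵥ (M *ᵥ x))) = √(2 * π) ^ n * (√M.det)⁻¹ := by
  obtain ⟨K, rfl⟩ : ∃ K : Matrix (Fin n) (Fin n) ℝ, M = Kᵀ * K := by
    open scoped MatrixOrder Matrix.Norms.L2Operator in
    exact CStarAlgebra.nonneg_iff_eq_star_mul_self.mp hM.posSemidef.nonneg
  have hdet : K.det ≠ 0 := by
    have := hM.det_pos
    intro h
    simp [h] at this
  have hq (x : Fin n → ℝ) : x ⬝ᵥ ((Kᵀ * K) *ᵥ x) = (K *ᵥ x) ⬝ᵥ (K *ᵥ x) := by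
    rw [← mulVec_mulVec, dotProduct_mulVec, vecMul_transpose]
  simp_rw [hq]
  rw [integral_comp_mulVec (fun y => Real.exp (-(1 / 2) * (y ⬝ᵥ y))) hdet,
    integral_exp_neg_half_dotProduct_self, det_mul, det_transpose, Real.sqrt_mul_self_eq_abs,
    mul_comm]

theorem dotProduct_mulVec_sub_self {n : ℕ} {M : Matrix (Fin n) (Fin n) ℝ} (hM : Mᵀ = M)
    (y z : Fin n → ℝ) :
    (y - z) ⬝ᵥ (M *ᵥ (y - z)) = y ⬝ᵥ (M *ᵥ y) - 2 * (y ⬝ᵥ (M *ᵥ z)) + z ⬝ᵥ (M *ᵥ z) := by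
  have h : z ⬝ᵥ (M *ᵥ y) = y ⬝ᵥ (M *ᵥ z) := by
    rw [dotProduct_mulVec, ← mulVec_transpose, hM, dotProduct_comm]
  simp only [mulVec_sub, dotProduct_sub, sub_dotProduct, h]
  ring

theorem kalman_complete_square {n : ℕ} {P Q : Matrix (Fin n) (Fin n) ℝ} (hP : P.PosDef)
    (hQ : Q.PosDef) {A S M : Matrix (Fin n) (Fin n) ℝ} (hS : S = A * P * Aᵀ + Q)
    (hSu : IsUnit S.det) (hM : M = P⁻¹ + Aᵀ * Q⁻¹ * A) (d y : Fin n → ℝ) :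
    (d - A *ᵥ y) ⬝ᵥ (Q⁻¹ *ᵥ (d - A *ᵥ y)) + y ⬝ᵥ (P⁻¹ *ᵥ y) =
      (y - (P * Aᵀ * S⁻¹) *ᵥ d) ⬝ᵥ (M *ᵥ (y - (P * Aᵀ * S⁻¹) *ᵥ d)) + d ⬝ᵥ (S⁻¹ *ᵥ d) := by
  have hPt : Pᵀ = P := by simpa using hP.isHermitian.eq
  have hQt : Qᵀ = Q := by simpa using hQ.isHermitian.eq
  have hPu : IsUnit P.det := hP.det_pos.ne'.isUnit
  have hQu : IsUnit Q.det := hQ.det_pos.ne'.isUnit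
  have hQit : Q⁻¹ᵀ = Q⁻¹ := by rw [transpose_nonsing_inv, hQt]
  have hMt : Mᵀ = M := by
    simp [hM, transpose_nonsing_inv, hPt, hQt, Matrix.mul_assoc]
  have hSt : Sᵀ = S := by simp [hS, hPt, hQt, Matrix.mul_assoc]
  have hgain : M * (P * Aᵀ * S⁻¹) = Aᵀ * Q⁻¹ := by
    calc M * (P * Aᵀ * S⁻¹) = (P⁻¹ * P * Aᵀ + Aᵀ * Q⁻¹ * (A * P * Aᵀ)) * S⁻¹ := by
          rw [hM]; noncomm_ring
      _ = (Aᵀ * (Q⁻¹ * Q) + Aᵀ * Q⁻¹ * (A * P * Aᵀ)) * S⁻¹ := by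
          rw [nonsing_inv_mul _ hPu, nonsing_inv_mul _ hQu, Matrix.one_mul, Matrix.mul_one]
      _ = Aᵀ * Q⁻¹ * (S * S⁻¹) := by
          nth_rw 2 [hS]; noncomm_ring
      _ = Aᵀ * Q⁻¹ := by rw [mul_nonsing_inv _ hSu, Matrix.mul_one]
  have hconst : (P * Aᵀ * S⁻¹)ᵀ * (Aᵀ * Q⁻¹) + S⁻¹ = Q⁻¹ := by
    calc (P * Aᵀ * S⁻¹)ᵀ * (Aᵀ * Q⁻¹) + S⁻¹
        = S⁻¹ * (A * P * Aᵀ) * Q⁻¹ + S⁻¹ := by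
          simp [transpose_nonsing_inv, hPt, hSt, Matrix.mul_assoc]
      _ = S⁻¹ * (A * P * Aᵀ) * Q⁻¹ + S⁻¹ * (Q * Q⁻¹) := by
          rw [mul_nonsing_inv _ hQu, Matrix.mul_one]
      _ = S⁻¹ * S * Q⁻¹ := by nth_rw 4 [hS]; noncomm_ring
      _ = Q⁻¹ := by rw [nonsing_inv_mul _ hSu, Matrix.one_mul]
  have hz : ((P * Aᵀ * S⁻¹) *ᵥ d) ⬝ᵥ ((Aᵀ * Q⁻¹) *ᵥ d) + d ⬝ᵥ (S⁻¹ *ᵥ d) =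
      d ⬝ᵥ (Q⁻¹ *ᵥ d) := by
    conv_rhs => rw [← hconst]
    rw [add_mulVec, dotProduct_add, ← mulVec_mulVec d (P * Aᵀ * S⁻¹)ᵀ,
      dotProduct_mulVec d (P * Aᵀ * S⁻¹)ᵀ, vecMul_transpose]
  have hlin : d ⬝ᵥ (Q⁻¹ *ᵥ (A *ᵥ y)) = y ⬝ᵥ ((Aᵀ * Q⁻¹) *ᵥ d) := by
    rw [← mulVec_mulVec, dotProduct_mulVec y, vecMul_transpose, dotProduct_mulVec d,
      ← mulVec_transpose, hQit, dotProduct_comm]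
  have hquad : y ⬝ᵥ (M *ᵥ y) = (A *ᵥ y) ⬝ᵥ (Q⁻¹ *ᵥ (A *ᵥ y)) + y ⬝ᵥ (P⁻¹ *ᵥ y) := by
    rw [hM, add_mulVec, dotProduct_add, Matrix.mul_assoc, ← mulVec_mulVec, ← mulVec_mulVec,
      dotProduct_mulVec y Aᵀ, vecMul_transpose, add_comm]
  rw [dotProduct_mulVec_sub_self hQit, dotProduct_mulVec_sub_self hMt, mulVec_mulVec d M, hgain,
    hquad, ← hz, ← hlin]
  ring

theorem det_kalman {n : ℕ} {P Q : Matrix (Fin n) (Fin n) ℝ} (hP : IsUnit P.det)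
    (hQ : IsUnit Q.det) (A : Matrix (Fin n) (Fin n) ℝ) :
    (A * P * Aᵀ + Q).det = Q.det * (P⁻¹ + Aᵀ * Q⁻¹ * A).det * P.det := by
  have h₁ : A * P * Aᵀ + Q = (1 + (A * P) * (Aᵀ * Q⁻¹)) * Q := by
    rw [Matrix.add_mul, Matrix.one_mul, Matrix.mul_assoc (A * P), Matrix.mul_assoc Aᵀ,
      nonsing_inv_mul _ hQ, Matrix.mul_one, add_comm]
  have h₂ : 1 + (Aᵀ * Q⁻¹) * (A * P) = (P⁻¹ + Aᵀ * Q⁻¹ * A) * P := by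
    rw [Matrix.add_mul, nonsing_inv_mul _ hP, Matrix.mul_assoc _ A]
  rw [h₁, det_mul, det_one_add_mul_comm, h₂, det_mul]
  ring

theorem det_two_pi_smul_rpow {n : ℕ} {P : Matrix (Fin n) (Fin n) ℝ} (hP : 0 < P.det) :
    ((2 * π) • P).det ^ (-(1 : ℝ) / 2) = (√(2 * π) ^ n)⁻¹ * (√P.det)⁻¹ := by
  have h : 0 ≤ 2 * π := by positivity
  rw [det_smul, Fintype.card_fin, neg_div, Real.rpow_neg (by positivity), ← Real.sqrt_eq_rpow,
    Real.sqrt_mul (by positivity), mul_inv]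
  congr 2
  rw [Real.sqrt_eq_iff_mul_self_eq (by positivity) (by positivity), ← mul_pow,
    Real.mul_self_sqrt h]

/-- Kalman prediction (marginalization) step of the forward filter. -/
theorem kalman_prediction {n q : ℕ}
    (P Q : Matrix (Fin n) (Fin n) ℝ) (hP : P.PosDef) (hQ : Q.PosDef)
    (A : Matrix (Fin n) (Fin n) ℝ) (B : Matrix (Fin n) (Fin q) ℝ)
    (μ : Fin n → ℝ) (u : Fin q → ℝ) :
    ∀ x' : Fin n → ℝ,
      (∫ x : Fin n → ℝ, gaussPdf x' (A *ᵥ x + B *ᵥ u) Q * gaussPdf x μ P)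
        = gaussPdf x' (A *ᵥ μ + B *ᵥ u) (A * P * Aᵀ + Q) := by
  intro x'
  have hS : (A * P * Aᵀ + Q).PosDef := by
    simpa using hQ.posSemidef_add (hP.posSemidef.mul_mul_conjTranspose_same A)
  have hM : (P⁻¹ + Aᵀ * Q⁻¹ * A).PosDef := by
    simpa using hP.inv.add_posSemidef (hQ.inv.posSemidef.conjTranspose_mul_mul_same A)
  set d := x' - (A *ᵥ μ + B *ᵥ u) with hd
  set S := A * P * Aᵀ + Q with hSdef
  set M := P⁻¹ + Aᵀ * Q⁻¹ * A with hMdef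
  set z := μ + (P * Aᵀ * S⁻¹) *ᵥ d with hz
  have hSu : IsUnit S.det := hS.det_pos.ne'.isUnit
  have hexp (x : Fin n → ℝ) : gaussPdf x' (A *ᵥ x + B *ᵥ u) Q * gaussPdf x μ P =
      ((√(2 * π) ^ n)⁻¹ * (√Q.det)⁻¹ * ((√(2 * π) ^ n)⁻¹ * (√P.det)⁻¹) *
        Real.exp (-(1 / 2) * (d ⬝ᵥ (S⁻¹ *ᵥ d)))) *
        Real.exp (-(1 / 2) * ((x - z) ⬝ᵥ (M *ᵥ (x - z)))) := by
    have h := kalman_complete_square hP hQ hSdef hSu hMdef d (x - μ)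
    have h₁ : d - A *ᵥ (x - μ) = x' - (A *ᵥ x + B *ᵥ u) := by
      rw [hd, mulVec_sub]; abel
    have h₂ : x - μ - (P * Aᵀ * S⁻¹) *ᵥ d = x - z := by rw [hz]; abel
    rw [h₁, h₂] at h
    rw [gaussPdf, gaussPdf, det_two_pi_smul_rpow hP.det_pos, det_two_pi_smul_rpow hQ.det_pos,
      mul_mul_mul_comm, ← Real.exp_add, ← mul_add, h, mul_assoc _ (Real.exp _), ← Real.exp_add,
      ← mul_add, add_comm (d ⬝ᵥ _)]
  simp_rw [hexp]
  rw [integral_const_mul,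
    integral_sub_right_eq_self (fun x => Real.exp (-(1 / 2) * (x ⬝ᵥ (M *ᵥ x)))) z,
    integral_exp_neg_half_quadratic hM, gaussPdf, det_two_pi_smul_rpow hS.det_pos, ← hd,
    hSdef, det_kalman hP.det_pos.ne'.isUnit hQ.det_pos.ne'.isUnit, ← hSdef, ← hMdef,
    Real.sqrt_mul (mul_pos hQ.det_pos hM.det_pos).le, Real.sqrt_mul hQ.det_pos.le]
  have h2 : √(2 * π) ≠ 0 := by positivity
  field_simp
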